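/- Let (X,d,f) be a topological dynamical system, φ,ψ ∈ C(X,ℝ), μ an f-invariant Borel probability measure, U a finite open cover of X, ε > 0, and δ > 0. Assume that sup over ergodic f-invariant measures τ of (inf_{ξ≻U} h_τ(f,ξ) + log(1/ε)·∫ψ dτ) is finite. Then there exists a measure ν of the form ν = Σ_{i=1}^j λ_i ν_i, where each λ_i > 0, Σ_{i=1}^j λ_i = 1, and each ν_i is an ergodic f-invariant Borel probability measure, such that: (i) inf_{ξ≻U} h_μ(f,ξ) + log(1/ε)·∫ψ dμ ≤ inf_{ξ≻U} h_ν(f,ξ) + log(1/ε)·∫ψ dν + δ, and (ii) |∫φ dν − ∫φ dμ| < δ. -/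

import Mathlib

open Filter Set Topology MeasureTheory
open scoped ENNReal NNReal Classical

namespace PaperMMD

variable {X : Type*}

/-- Birkhoff sum `S_n ψ(x) = ∑_{i=0}^{n-1} ψ(f^i x)`. -/
noncomputable def birkhoff (f : X → X) (ψ : X → ℝ) (n : ℕ) (x : X) : ℝ :=
  ∑ i ∈ Finset.range n, ψ (f^[i] x)

section Metric

variable [MetricSpace X]

/-- Open Bowen ball `B_n(x,ε)` for the Bowen metric `d_n`. -/
def bowenBall (f : X → X) (n : ℕ) (x : X) (ε : ℝ) : Set X :=
  {y | ∀ j < n, dist (f^[j] x) (f^[j] y) < ε}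

/-- Closed Bowen ball. -/
def bowenClosedBall (f : X → X) (n : ℕ) (x : X) (ε : ℝ) : Set X :=
  {y | ∀ j < n, dist (f^[j] x) (f^[j] y) ≤ ε}

/-- The specification property. -/
def Specification (f : X → X) : Prop :=
  ∀ ε : ℝ, 0 < ε → ∃ m : ℕ, ∀ (k : ℕ) (a b : Fin k → ℕ) (xs : Fin k → X),
    (∀ j, a j ≤ b j) →
    (∀ (j : ℕ) (hj : j + 1 < k), b ⟨j, Nat.lt_of_succ_lt hj⟩ + m ≤ a ⟨j + 1, hj⟩) →
    ∃ x : X, ∀ j : Fin k, ∀ i < b j - a j,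
      dist (f^[a j + i] x) (f^[i] (xs j)) < ε

/-- The level set `K_α = {x : lim (1/n) S_n φ(x) = α}`. -/
def Kset (f : X → X) (φ : X → ℝ) (α : ℝ) : Set X :=
  {x | Tendsto (fun n : ℕ => birkhoff f φ n x / (n : ℝ)) atTop (𝓝 α)}

/-- The weight `exp(-s n + S_n ψ(x) log(1/ε))`, as a value in `ℝ≥0∞`. -/
noncomputable def wt (f : X → X) (ψ : X → ℝ) (s ε : ℝ) (n : ℕ) (x : X) : ℝ≥0∞ :=
  ENNReal.ofReal (Real.exp (-(s * (n : ℝ)) + birkhoff f ψ n x * Real.log (1 / ε)))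

/-- `m_{N,ε}(f,Z,s,d,ψ)`: infimum over finite or countable Bowen-ball covers of `Z`
with orders at least `N` of the sum of the weights. -/
noncomputable def mBowen (f : X → X) (ψ : X → ℝ) (Z : Set X) (s ε : ℝ) (N : ℕ) : ℝ≥0∞ :=
  sInf {r : ℝ≥0∞ | ∃ (I : Set ℕ) (x : ℕ → X) (n : ℕ → ℕ),
    (∀ i ∈ I, N ≤ n i) ∧ (Z ⊆ ⋃ i ∈ I, bowenBall f (n i) (x i) ε) ∧
    r = ∑' i : I, wt f ψ s ε (n i.1) (x i.1)}

/-- `m_ε(f,Z,s,d,ψ) = lim_{N→∞} m_{N,ε}`; the limit of the nondecreasing sequence equals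
the supremum. -/
noncomputable def mBowenLim (f : X → X) (ψ : X → ℝ) (Z : Set X) (s ε : ℝ) : ℝ≥0∞ :=
  ⨆ N : ℕ, mBowen f ψ Z s ε N

/-- `M_ε(f,Z,d,ψ) = inf{s : m_ε(f,Z,s,d,ψ) = 0}`. -/
noncomputable def bowenCrit (f : X → X) (ψ : X → ℝ) (Z : Set X) (ε : ℝ) : ℝ :=
  sInf {s : ℝ | mBowenLim f ψ Z s ε = 0}

/-- Bowen upper metric mean dimension of `f` on `Z` with potential `ψ`. -/
noncomputable def mdimBowenUpper (f : X → X) (ψ : X → ℝ) (Z : Set X) : ℝ :=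
  limsup (fun ε : ℝ => bowenCrit f ψ Z ε / Real.log (1 / ε)) (𝓝[>] (0 : ℝ))

/-- Bowen lower metric mean dimension of `f` on `Z` with potential `ψ`. -/
noncomputable def mdimBowenLower (f : X → X) (ψ : X → ℝ) (Z : Set X) : ℝ :=
  liminf (fun ε : ℝ => bowenCrit f ψ Z ε / Real.log (1 / ε)) (𝓝[>] (0 : ℝ))

/-- `P_{N,ε}(f,Z,s,d,ψ)`: supremum over finite or countable pairwise disjoint families
of closed Bowen balls centred in `Z` with orders at least `N` of the sum of the weights. -/
noncomputable def pPack (f : X → X) (ψ : X → ℝ) (Z : Set X) (s ε : ℝ) (N : ℕ) : ℝ≥0∞ :=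
  sSup {r : ℝ≥0∞ | ∃ (I : Set ℕ) (x : ℕ → X) (n : ℕ → ℕ),
    (∀ i ∈ I, N ≤ n i) ∧ (∀ i ∈ I, x i ∈ Z) ∧
    (I.Pairwise fun i j =>
      Disjoint (bowenClosedBall f (n i) (x i) ε) (bowenClosedBall f (n j) (x j) ε)) ∧
    r = ∑' i : I, wt f ψ s ε (n i.1) (x i.1)}

/-- `P_ε(f,Z,s,d,ψ) = lim_{N→∞} P_{N,ε}`; the limit of the nonincreasing sequence equals
the infimum. -/
noncomputable def pPackLim (f : X → X) (ψ : X → ℝ) (Z : Set X) (s ε : ℝ) : ℝ≥0∞ :=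
  ⨅ N : ℕ, pPack f ψ Z s ε N

/-- `𝒫_ε(f,Z,s,d,ψ) = inf{∑_i P_ε(f,Z_i,s,d,ψ) : Z ⊆ ∪_i Z_i}`. -/
noncomputable def packMeasure (f : X → X) (ψ : X → ℝ) (Z : Set X) (s ε : ℝ) : ℝ≥0∞ :=
  sInf {r : ℝ≥0∞ | ∃ Zs : ℕ → Set X, (Z ⊆ ⋃ i, Zs i) ∧
    r = ∑' i : ℕ, pPackLim f ψ (Zs i) s ε}

/-- `𝒫_ε(f,Z,d,ψ) = inf{s : 𝒫_ε(f,Z,s,d,ψ) = 0}`. -/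
noncomputable def packCrit (f : X → X) (ψ : X → ℝ) (Z : Set X) (ε : ℝ) : ℝ :=
  sInf {s : ℝ | packMeasure f ψ Z s ε = 0}

/-- Packing upper metric mean dimension of `f` on `Z` with potential `ψ`. -/
noncomputable def mdimPackUpper (f : X → X) (ψ : X → ℝ) (Z : Set X) : ℝ :=
  limsup (fun ε : ℝ => packCrit f ψ Z ε / Real.log (1 / ε)) (𝓝[>] (0 : ℝ))

/-- Packing lower metric mean dimension of `f` on `Z` with potential `ψ`. -/
noncomputable def mdimPackLower (f : X → X) (ψ : X → ℝ) (Z : Set X) : ℝ :=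
  liminf (fun ε : ℝ => packCrit f ψ Z ε / Real.log (1 / ε)) (𝓝[>] (0 : ℝ))

/-- `P(α,δ,n) = {x : |(1/n) S_n φ(x) - α| < δ}`. -/
def levelApprox (f : X → X) (φ : X → ℝ) (α δ : ℝ) (n : ℕ) : Set X :=
  {x | |birkhoff f φ n x / (n : ℝ) - α| < δ}

/-- `F` is an `(n,ε)`-spanning set for `Z`. -/
def IsSpanningSet (f : X → X) (n : ℕ) (ε : ℝ) (F Z : Set X) : Prop :=
  ∀ z ∈ Z, ∃ x ∈ F, ∀ j < n, dist (f^[j] x) (f^[j] z) < ε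

/-- `E` is an `(n,ε)`-separated set. -/
def IsSepSet (f : X → X) (n : ℕ) (ε : ℝ) (E : Set X) : Prop :=
  E.Pairwise fun x y => ∃ j < n, ε ≤ dist (f^[j] x) (f^[j] y)

/-- `∑_{x ∈ F} exp(S_n ψ(x) log(1/ε))`, as a value in `ℝ≥0∞`. -/
noncomputable def spanSum (f : X → X) (ψ : X → ℝ) (n : ℕ) (ε : ℝ) (F : Set X) : ℝ≥0∞ :=
  ∑' x : F, ENNReal.ofReal (Real.exp (birkhoff f ψ n x.1 * Real.log (1 / ε)))

/-- `N(α,δ,n,ε,ψ)`: infimum over `(n,ε)`-spanning sets of `P(α,δ,n)`. -/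
noncomputable def Nspan (f : X → X) (φ ψ : X → ℝ) (α δ : ℝ) (n : ℕ) (ε : ℝ) : ℝ≥0∞ :=
  sInf {r : ℝ≥0∞ | ∃ F : Set X,
    IsSpanningSet f n ε F (levelApprox f φ α δ n) ∧ r = spanSum f ψ n ε F}

/-- `M(α,δ,n,ε,ψ)`: supremum over `(n,ε)`-separated subsets of `P(α,δ,n)`. -/
noncomputable def Msep (f : X → X) (φ ψ : X → ℝ) (α δ : ℝ) (n : ℕ) (ε : ℝ) : ℝ≥0∞ :=
  sSup {r : ℝ≥0∞ | ∃ E : Set X,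
    E ⊆ levelApprox f φ α δ n ∧ IsSepSet f n ε E ∧ r = spanSum f ψ n ε E}

/-- `Λ_φ^ψ(α,ε) = lim_{δ→0} liminf_{n→∞} (1/n) log N(α,δ,n,ε,ψ)`; since the inner
quantity is monotone in `δ`, the limit as `δ → 0⁺` is the infimum over `δ > 0`. -/
noncomputable def lamAux (f : X → X) (φ ψ : X → ℝ) (α ε : ℝ) : ℝ :=
  ⨅ (δ : ℝ) (_ : 0 < δ),
    liminf (fun n : ℕ => Real.log (Nspan f φ ψ α δ n ε).toReal / (n : ℝ)) atTop

/-- `Γ_φ^ψ(α,ε)`: the analogue of `Λ_φ^ψ(α,ε)` defined via separated sets. -/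
noncomputable def gamAux (f : X → X) (φ ψ : X → ℝ) (α ε : ℝ) : ℝ :=
  ⨅ (δ : ℝ) (_ : 0 < δ),
    liminf (fun n : ℕ => Real.log (Msep f φ ψ α δ n ε).toReal / (n : ℝ)) atTop

/-- `Λ_φ`-upper metric mean dimension: `limsup_{ε→0} Λ_φ^ψ(α,ε)/log(1/ε)`. -/
noncomputable def lamUpper (f : X → X) (φ ψ : X → ℝ) (α : ℝ) : ℝ :=
  limsup (fun ε : ℝ => lamAux f φ ψ α ε / Real.log (1 / ε)) (𝓝[>] (0 : ℝ))

/-- `Λ_φ`-lower metric mean dimension: `liminf_{ε→0} Λ_φ^ψ(α,ε)/log(1/ε)`. -/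
noncomputable def lamLower (f : X → X) (φ ψ : X → ℝ) (α : ℝ) : ℝ :=
  liminf (fun ε : ℝ => lamAux f φ ψ α ε / Real.log (1 / ε)) (𝓝[>] (0 : ℝ))

/-- The separated-set analogue of `lamUpper`, built from `Γ_φ^ψ`. -/
noncomputable def gamUpper (f : X → X) (φ ψ : X → ℝ) (α : ℝ) : ℝ :=
  limsup (fun ε : ℝ => gamAux f φ ψ α ε / Real.log (1 / ε)) (𝓝[>] (0 : ℝ))

section MeasureTheoretic

variable [MeasurableSpace X]

/-- A finite Borel partition of `X`. -/
def IsFinPartition (ξ : Finset (Set X)) : Prop :=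
  (∀ B ∈ ξ, MeasurableSet B) ∧ (⋃ B ∈ ξ, B) = Set.univ ∧
    (ξ : Set (Set X)).PairwiseDisjoint id

/-- The entropy `H_μ(ξ) = -∑_{B ∈ ξ} μ(B) log μ(B)` of a finite partition. -/
noncomputable def partEnt (μ : Measure X) (ξ : Finset (Set X)) : ℝ :=
  -∑ B ∈ ξ, (μ B).toReal * Real.log (μ B).toReal

/-- The dynamical refinement `⋁_{j=0}^{n-1} f^{-j} ξ`. -/
noncomputable def dynRefine (f : X → X) (ξ : Finset (Set X)) : ℕ → Finset (Set X)
  | 0 => {Set.univ}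
  | n + 1 => Finset.image₂ (fun A B => A ∩ f^[n] ⁻¹' B) (dynRefine f ξ n) ξ

/-- The metric entropy `h_μ(f,ξ) = lim_n (1/n) H_μ(⋁_{j<n} f^{-j}ξ)`; the limit exists
and equals the `liminf`. -/
noncomputable def entPart (μ : Measure X) (f : X → X) (ξ : Finset (Set X)) : ℝ :=
  liminf (fun n : ℕ => partEnt μ (dynRefine f ξ n) / (n : ℝ)) atTop

/-- `sup_{μ ∈ M_f(X,φ,α)} ( inf_{diam ξ < ε} h_μ(f,ξ) + log(1/ε) ∫ψ dμ )`. -/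
noncomputable def Hsup (f : X → X) (φ ψ : X → ℝ) (α ε : ℝ) : ℝ :=
  sSup {r : ℝ | ∃ μ : Measure X, IsProbabilityMeasure μ ∧ μ.map f = μ ∧
    (∫ x, φ x ∂μ) = α ∧
    r = sInf {h : ℝ | ∃ ξ : Finset (Set X), IsFinPartition ξ ∧
          (∀ B ∈ ξ, Metric.diam B < ε) ∧ h = entPart μ f ξ}
        + Real.log (1 / ε) * ∫ x, ψ x ∂μ}

/-- `H_φ`-upper metric mean dimension. -/
noncomputable def Hupper (f : X → X) (φ ψ : X → ℝ) (α : ℝ) : ℝ :=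
  limsup (fun ε : ℝ => Hsup f φ ψ α ε / Real.log (1 / ε)) (𝓝[>] (0 : ℝ))

/-- `H_φ`-lower metric mean dimension. -/
noncomputable def Hlower (f : X → X) (φ ψ : X → ℝ) (α : ℝ) : ℝ :=
  liminf (fun ε : ℝ => Hsup f φ ψ α ε / Real.log (1 / ε)) (𝓝[>] (0 : ℝ))

/-- `inf_{ξ ≻ U} h_μ(f,ξ)`: the infimum of `h_μ(f,ξ)` over finite Borel partitions `ξ`
each of whose elements is contained in some element of the cover `U`. -/
noncomputable def entInfCover (μ : Measure X) (f : X → X) (U : Finset (Set X)) : ℝ :=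
  sInf {h : ℝ | ∃ ξ : Finset (Set X), IsFinPartition ξ ∧
    (∀ B ∈ ξ, ∃ u ∈ U, B ⊆ u) ∧ h = entPart μ f ξ}

end MeasureTheoretic

end Metric

end PaperMMD
universe u

namespace PaperMMD

section LabelEntropy

variable {X ι κ : Type*} [MeasurableSpace X] [Fintype ι] [Fintype κ] {μ ν : Measure X}

/-- The entropy of the finite partition into the fibres of `c`. -/
noncomputable def labelEnt (μ : Measure X) (c : X → ι) : ℝ :=
  ∑ i, Real.negMulLog (μ.real (c ⁻¹' {i}))

/-- The length-`n` itinerary of a point under `f`, as seen through the labelling `c`. -/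
def itin {ι : Type*} (f : X → X) (c : X → ι) (n : ℕ) (x : X) : Fin n → ι := fun j => c (f^[j] x)

/-- All fibres of `c` are measurable. -/
def MeasFibers {ι : Type*} (c : X → ι) : Prop := ∀ i, MeasurableSet (c ⁻¹' {i})

theorem MeasFibers.itin {ι : Type*} {f : X → X} (hf : Measurable f) {c : X → ι}
    (hc : MeasFibers c) (n : ℕ) : MeasFibers (itin f c n) := by
  intro s
  have : PaperMMD.itin f c n ⁻¹' {s} = ⋂ j : Fin n, f^[j] ⁻¹' (c ⁻¹' {s j}) := by
    ext x
    simp [PaperMMD.itin, funext_iff]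
  rw [this]
  exact MeasurableSet.iInter fun j => (hf.iterate j) (hc _)

theorem sum_measureReal_fiber [IsFiniteMeasure μ] {c : X → ι} (hc : MeasFibers c) :
    ∑ i, μ.real (c ⁻¹' {i}) = μ.real univ := by
  rw [sum_measureReal_preimage_singleton]
  · simp
  · exact fun i _ => hc i

theorem sum_measureReal_inter_fiber [IsFiniteMeasure μ] {c : X → ι} (hc : MeasFibers c)
    (s : Set X) : ∑ i, μ.real (s ∩ c ⁻¹' {i}) = μ.real s := by
  have := sum_measureReal_fiber (μ := μ.restrict s) hc
  simp only [measureReal_restrict_apply_univ] at this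
  rw [← this]
  exact Finset.sum_congr rfl fun i _ => by rw [measureReal_restrict_apply (hc i), inter_comm]

theorem sum_negMulLog_le (p : ι → κ → ℝ) (hp : ∀ i j, 0 ≤ p i j) (hM : ∑ i, ∑ j, p i j ≤ 1) :
    ∑ i, ∑ j, Real.negMulLog (p i j) ≤
      ∑ i, Real.negMulLog (∑ j, p i j) + ∑ j, Real.negMulLog (∑ i, p i j) := by
  set q : ι → ℝ := fun i => ∑ j, p i j with hq
  set r : κ → ℝ := fun j => ∑ i, p i j with hr
  have hqp : ∀ i j, p i j ≤ q i := fun i j =>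
    Finset.single_le_sum (f := fun j => p i j) (fun j _ => hp i j) (Finset.mem_univ j)
  have hrp : ∀ i j, p i j ≤ r j := fun i j =>
    Finset.single_le_sum (f := fun i => p i j) (fun i _ => hp i j) (Finset.mem_univ i)
  have key : ∀ i j, Real.negMulLog (p i j) ≤
      -(p i j * Real.log (q i)) - p i j * Real.log (r j) + (q i * r j - p i j) := by
    intro i j
    rcases (hp i j).eq_or_lt with h | h
    · simp only [← h, Real.negMulLog_zero]
      have := mul_nonneg ((hp i j).trans (hqp i j)) ((hp i j).trans (hrp i j))
      linarith
    · have h1 := h.trans_le (hqp i j)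
      have h2 := h.trans_le (hrp i j)
      have := Real.log_le_sub_one_of_pos (show 0 < q i * r j / p i j by positivity)
      rw [Real.log_div (by positivity) h.ne', Real.log_mul h1.ne' h2.ne'] at this
      have := mul_le_mul_of_nonneg_left this h.le
      have h3 : p i j * (q i * r j / p i j - 1) = q i * r j - p i j := by field_simp
      rw [h3] at this
      simp only [Real.negMulLog]
      linarith
  have hqs : ∑ i, q i = ∑ i, ∑ j, p i j := rfl
  have hrs : ∑ j, r j = ∑ i, ∑ j, p i j := Finset.sum_comm
  have h0 : 0 ≤ ∑ i, ∑ j, p i j := Finset.sum_nonneg fun i _ => Finset.sum_nonneg fun j _ => hp i j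
  calc ∑ i, ∑ j, Real.negMulLog (p i j)
      ≤ ∑ i, ∑ j, (-(p i j * Real.log (q i)) - p i j * Real.log (r j) + (q i * r j - p i j)) :=
        Finset.sum_le_sum fun i _ => Finset.sum_le_sum fun j _ => key i j
    _ = ∑ i, Real.negMulLog (q i) + ∑ j, Real.negMulLog (r j)
          + ((∑ i, ∑ j, p i j) * (∑ i, ∑ j, p i j) - ∑ i, ∑ j, p i j) := by
        have e1 : ∑ i, ∑ j, p i j * Real.log (q i) = ∑ i, q i * Real.log (q i) := by
          simp only [← Finset.sum_mul, hq]
        have e2 : ∑ i, ∑ j, p i j * Real.log (r j) = ∑ j, r j * Real.log (r j) := by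
          rw [Finset.sum_comm]
          simp only [← Finset.sum_mul, hr]
        have e3 : ∑ i, ∑ j, q i * r j = (∑ i, ∑ j, p i j) * (∑ i, ∑ j, p i j) := by
          nth_rewrite 2 [← hrs]
          rw [← hqs, Finset.sum_mul_sum]
        simp only [Finset.sum_add_distrib, Finset.sum_sub_distrib, Finset.sum_neg_distrib, e1, e2,
          e3, Real.negMulLog, neg_mul]
        ring
    _ ≤ _ := by nlinarith

theorem labelEnt_prod_le [IsFiniteMeasure μ] (hμ : μ.real univ ≤ 1) {c : X → ι} {d : X → κ}
    (hc : MeasFibers c) (hd : MeasFibers d) :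
    labelEnt μ (fun x => (c x, d x)) ≤ labelEnt μ c + labelEnt μ d := by
  have hpre : ∀ i j, (fun x => (c x, d x)) ⁻¹' {(i, j)} = c ⁻¹' {i} ∩ d ⁻¹' {j} := by
    intro i j; ext x; simp
  have hrow : ∀ i, ∑ j, μ.real (c ⁻¹' {i} ∩ d ⁻¹' {j}) = μ.real (c ⁻¹' {i}) := fun i =>
    sum_measureReal_inter_fiber hd _
  have hcol : ∀ j, ∑ i, μ.real (c ⁻¹' {i} ∩ d ⁻¹' {j}) = μ.real (d ⁻¹' {j}) := fun j => by
    simpa only [inter_comm] using sum_measureReal_inter_fiber hc (d ⁻¹' {j})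
  have := sum_negMulLog_le (fun i j => μ.real (c ⁻¹' {i} ∩ d ⁻¹' {j}))
    (fun _ _ => measureReal_nonneg) (by simp only [hrow, sum_measureReal_fiber hc, hμ])
  simp only [hrow, hcol] at this
  simpa only [labelEnt, Fintype.sum_prod_type, hpre] using this

theorem labelEnt_comp_injective {e : ι → κ} (he : Function.Injective e) (c : X → ι) :
    labelEnt μ (e ∘ c) = labelEnt μ c := by
  unfold labelEnt
  refine (Finset.sum_of_injOn e he.injOn (fun _ _ => Finset.mem_coe.2 (Finset.mem_univ _))
    (fun k _ hk => ?_) fun i _ => ?_).symm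
  · have : e ∘ c ⁻¹' {k} = ∅ := by
      ext x
      simp only [mem_preimage, Function.comp_apply, mem_singleton_iff, mem_empty_iff_false, iff_false]
      rintro rfl
      exact hk ⟨c x, by simp⟩
    simp [this]
  · congr 2
    ext x
    simp [he.eq_iff]

theorem labelEnt_comp_measurePreserving {f : X → X} (hf : MeasurePreserving f μ μ) {c : X → ι}
    (hc : MeasFibers c) : labelEnt μ (c ∘ f) = labelEnt μ c := by
  unfold labelEnt
  refine Finset.sum_congr rfl fun i _ => ?_
  rw [preimage_comp, measureReal_def, hf.measure_preimage (hc i).nullMeasurableSet,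
    measureReal_def]

theorem labelEnt_nonneg (hμ : μ.real univ ≤ 1) [IsFiniteMeasure μ] (c : X → ι) :
    0 ≤ labelEnt μ c :=
  Finset.sum_nonneg fun _ _ => Real.negMulLog_nonneg measureReal_nonneg
    ((measureReal_mono (subset_univ _)).trans hμ)

theorem labelEnt_congr_ae {c d : X → ι} (h : c =ᵐ[μ] d) : labelEnt μ c = labelEnt μ d := by
  unfold labelEnt
  refine Finset.sum_congr rfl fun i _ => ?_
  congr 1
  refine measureReal_congr ?_
  filter_upwards [h] with x hx
  exact propext (by change c x ∈ ({i} : Set ι) ↔ d x ∈ ({i} : Set ι); rw [hx])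

theorem labelEnt_smul [IsFiniteMeasure μ] {c : X → ι} (hc : MeasFibers c) (a : ℝ≥0) :
    labelEnt (a • μ) c = a * labelEnt μ c + Real.negMulLog a * μ.real univ := by
  unfold labelEnt
  have : ∀ s, (a • μ).real s = a * μ.real s := fun s => by
    simp [measureReal_def]
  simp only [this, Real.negMulLog_mul, Finset.sum_add_distrib, ← Finset.sum_mul, ← Finset.mul_sum,
    sum_measureReal_fiber hc]
  ring

theorem negMulLog_add_le {x y : ℝ} (hx : 0 ≤ x) (hy : 0 ≤ y) :
    Real.negMulLog (x + y) ≤ Real.negMulLog x + Real.negMulLog y := by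
  rcases hx.eq_or_lt with rfl | hx
  · simp
  rcases hy.eq_or_lt with rfl | hy
  · simp
  have h1 := mul_le_mul_of_nonneg_left (Real.log_le_log hx (by linarith : x ≤ x + y)) hx.le
  have h2 := mul_le_mul_of_nonneg_left (Real.log_le_log hy (by linarith : y ≤ x + y)) hy.le
  simp only [Real.negMulLog]
  linarith

theorem le_negMulLog_add {x y : ℝ} (hx : 0 ≤ x) (hy : 0 ≤ y) :
    Real.negMulLog x + Real.negMulLog y ≤ Real.negMulLog (x + y) + (x + y) * Real.log 2 := by
  have h := Real.concaveOn_negMulLog.2 (mem_Ici.2 hx) (mem_Ici.2 hy)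
    (show (0 : ℝ) ≤ 1 / 2 by norm_num) (show (0 : ℝ) ≤ 1 / 2 by norm_num) (by norm_num)
  have e : (1 / 2 : ℝ) • x + (1 / 2 : ℝ) • y = (1 / 2) * (x + y) := by simp; ring
  rw [e, Real.negMulLog_mul] at h
  have e2 : Real.negMulLog (1 / 2) = Real.log 2 / 2 := by
    simp [Real.negMulLog]; ring
  rw [e2] at h
  simp only [smul_eq_mul] at h
  linarith

theorem labelEnt_add_le [IsFiniteMeasure μ] [IsFiniteMeasure ν] (c : X → ι) :
    labelEnt (μ + ν) c ≤ labelEnt μ c + labelEnt ν c := by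
  unfold labelEnt
  rw [← Finset.sum_add_distrib]
  refine Finset.sum_le_sum fun i _ => ?_
  rw [measureReal_add_apply]
  exact negMulLog_add_le measureReal_nonneg measureReal_nonneg

theorem le_labelEnt_add [IsFiniteMeasure μ] [IsFiniteMeasure ν] {c : X → ι} (hc : MeasFibers c) :
    labelEnt μ c + labelEnt ν c ≤ labelEnt (μ + ν) c + (μ + ν).real univ * Real.log 2 := by
  rw [← sum_measureReal_fiber hc, Finset.sum_mul]
  unfold labelEnt
  rw [← Finset.sum_add_distrib, ← Finset.sum_add_distrib]
  refine Finset.sum_le_sum fun i _ => ?_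
  rw [measureReal_add_apply]
  exact le_negMulLog_add measureReal_nonneg measureReal_nonneg

end LabelEntropy

section EntropyRate

variable {X ι κ : Type*} [MeasurableSpace X] [Fintype ι] [Fintype κ] {μ ν : Measure X} {f : X → X}

/-- The entropy rate of the process of labels `c ∘ f^[n]`. -/
noncomputable def entRate (μ : Measure X) (f : X → X) (c : X → ι) : ℝ :=
  liminf (fun n : ℕ => labelEnt μ (itin f c n) / (n : ℝ)) atTop

omit [MeasurableSpace X] in
theorem itin_add {ι : Type*} (f : X → X) (c : X → ι) (m n : ℕ) :
    itin f c (m + n) =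
      Fin.appendEquiv m n ∘ fun x => (itin f c m x, (itin f c n ∘ f^[m]) x) := by
  funext x j
  refine Fin.addCases (fun i => ?_) (fun i => ?_) j
  · simp [itin, Fin.appendEquiv]
  · simp [itin, Fin.appendEquiv, ← Function.iterate_add_apply, add_comm]

variable [IsFiniteMeasure μ] [IsFiniteMeasure ν]

theorem subadditive_labelEnt (hf : MeasurePreserving f μ μ) (hμ : μ.real univ ≤ 1) {c : X → ι}
    (hc : MeasFibers c) : Subadditive fun n => labelEnt μ (itin f c n) := by
  intro m n
  have hn := hc.itin hf.measurable n
  change labelEnt μ (itin f c (m + n)) ≤ labelEnt μ (itin f c m) + labelEnt μ (itin f c n)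
  rw [itin_add, labelEnt_comp_injective (Fin.appendEquiv m n).injective,
    ← labelEnt_comp_measurePreserving (hf.iterate m) hn]
  exact labelEnt_prod_le hμ (hc.itin hf.measurable m)
    fun i => by rw [preimage_comp]; exact (hf.measurable.iterate m) (hn i)

theorem bddBelow_labelEnt_div (hμ : μ.real univ ≤ 1) (f : X → X) (c : X → ι) :
    BddBelow (range fun n : ℕ => labelEnt μ (itin f c n) / n) := by
  refine ⟨0, ?_⟩
  rintro _ ⟨n, rfl⟩
  exact div_nonneg (labelEnt_nonneg hμ _) n.cast_nonneg

theorem tendsto_entRate (hf : MeasurePreserving f μ μ) (hμ : μ.real univ ≤ 1) {c : X → ι}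
    (hc : MeasFibers c) :
    Tendsto (fun n : ℕ => labelEnt μ (itin f c n) / n) atTop (𝓝 (entRate μ f c)) := by
  have := (subadditive_labelEnt hf hμ hc).tendsto_lim (bddBelow_labelEnt_div hμ f c)
  rwa [entRate, this.liminf_eq]

theorem entRate_le_div (hf : MeasurePreserving f μ μ) (hμ : μ.real univ ≤ 1) {c : X → ι}
    (hc : MeasFibers c) {n : ℕ} (hn : n ≠ 0) : entRate μ f c ≤ labelEnt μ (itin f c n) / n := by
  have h := (subadditive_labelEnt hf hμ hc).lim_le_div (bddBelow_labelEnt_div hμ f c) hn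
  rwa [← ((subadditive_labelEnt hf hμ hc).tendsto_lim
    (bddBelow_labelEnt_div hμ f c)).liminf_eq] at h

theorem entRate_nonneg (hf : MeasurePreserving f μ μ) (hμ : μ.real univ ≤ 1) {c : X → ι}
    (hc : MeasFibers c) : 0 ≤ entRate μ f c :=
  ge_of_tendsto' (tendsto_entRate hf hμ hc) fun n => div_nonneg (labelEnt_nonneg hμ _) n.cast_nonneg

theorem entRate_smul (hf : MeasurePreserving f μ μ) (hμ : μ.real univ ≤ 1) {c : X → ι}
    (hc : MeasFibers c) (a : ℝ≥0) : entRate (a • μ) f c = a * entRate μ f c := by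
  have h := ((tendsto_entRate hf hμ hc).const_mul (a : ℝ)).add
    (tendsto_const_div_atTop_nhds_zero_nat (Real.negMulLog a * μ.real univ))
  rw [add_zero] at h
  refine Tendsto.liminf_eq (h.congr fun n => ?_)
  rw [labelEnt_smul (hc.itin hf.measurable n)]
  ring

theorem entRate_add (hfμ : MeasurePreserving f μ μ) (hfν : MeasurePreserving f ν ν)
    (hμν : (μ + ν).real univ ≤ 1) {c : X → ι} (hc : MeasFibers c) :
    entRate (μ + ν) f c = entRate μ f c + entRate ν f c := by
  have hsum : μ.real univ + ν.real univ ≤ 1 := by rwa [← measureReal_add_apply]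
  have hμ : μ.real univ ≤ 1 := by linarith [measureReal_nonneg (μ := ν) (s := univ)]
  have hν : ν.real univ ≤ 1 := by linarith [measureReal_nonneg (μ := μ) (s := univ)]
  have h := (tendsto_entRate hfμ hμ hc).add (tendsto_entRate hfν hν hc)
  have h' := h.sub (tendsto_const_div_atTop_nhds_zero_nat ((μ + ν).real univ * Real.log 2))
  rw [sub_zero] at h'
  refine Tendsto.liminf_eq (tendsto_of_tendsto_of_tendsto_of_le_of_le h' h (fun n => ?_) fun n => ?_)
  · change _ / _ + _ / _ - _ / _ ≤ _ / _
    rw [← add_div, ← sub_div]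
    gcongr
    linarith [le_labelEnt_add (μ := μ) (ν := ν) (hc.itin hfμ.measurable n)]
  · change _ / _ ≤ _ / _ + _ / _
    rw [← add_div]
    gcongr
    exact labelEnt_add_le _

omit [IsFiniteMeasure μ] [IsFiniteMeasure ν]

theorem entRate_congr_of_injective {e : ι → κ} (he : Function.Injective e)
    (hf : MeasurePreserving f μ μ) {c : X → ι} {d : X → κ} (h : d =ᵐ[μ] e ∘ c) :
    entRate μ f d = entRate μ f c := by
  unfold entRate
  congr 1
  funext n
  congr 1
  rw [← labelEnt_comp_injective (he.comp_left (α := Fin n))]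
  refine labelEnt_congr_ae ?_
  have : ∀ j : Fin n, ∀ᵐ x ∂μ, d (f^[j] x) = e (c (f^[j] x)) := fun j =>
    (hf.iterate j).quasiMeasurePreserving.ae h
  filter_upwards [ae_all_iff.2 this] with x hx
  funext j
  exact hx j

end EntropyRate

section CoverEntropy

variable {X ι : Type*} [MeasurableSpace X] [Fintype ι] {μ : Measure X} {f : X → X}

/-- The finite family of fibres of a labelling. -/
noncomputable def fibers {X : Type*} (c : X → ι) : Finset (Set X) :=
  Finset.univ.image fun i => c ⁻¹' {i}

omit [MeasurableSpace X] in
theorem dynRefine_fibers (f : X → X) (c : X → ι) (n : ℕ) :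
    dynRefine f (fibers c) n = fibers (itin f c n) := by
  induction n with
  | zero =>
    ext A
    have : ∀ s : Fin 0 → ι, itin f c 0 ⁻¹' {s} = univ := fun s =>
      eq_univ_of_forall fun x => Subsingleton.elim _ _
    simp [dynRefine, fibers, this]
  | succ n ih =>
    ext A
    have key : ∀ (s : Fin n → ι) (i : ι), itin f c (n + 1) ⁻¹' {Fin.snoc s i} =
        itin f c n ⁻¹' {s} ∩ f^[n] ⁻¹' (c ⁻¹' {i}) := by
      intro s i
      ext x
      simp [itin, funext_iff, Fin.forall_fin_succ']
    simp only [dynRefine, ih]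
    simp only [fibers, Finset.mem_image₂, Finset.mem_image, Finset.mem_univ, true_and]
    constructor
    · rintro ⟨_, ⟨s, rfl⟩, _, ⟨i, rfl⟩, rfl⟩
      exact ⟨Fin.snoc s i, key s i⟩
    · rintro ⟨s, rfl⟩
      refine ⟨_, ⟨Fin.init s, rfl⟩, _, ⟨s (Fin.last n), rfl⟩, ?_⟩
      rw [← key, Fin.snoc_init_self]

theorem partEnt_fibers (c : X → ι) : partEnt μ (fibers c) = labelEnt μ c := by
  unfold partEnt fibers labelEnt
  rw [← Finset.sum_neg_distrib, Finset.sum_image_of_pairwise_eq_zero]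
  · exact Finset.sum_congr rfl fun i _ => by simp [Real.negMulLog, measureReal_def]
  · intro i _ j _ hij h
    have : c ⁻¹' {i} = ∅ := by
      have h1 : c ⁻¹' {i} ∩ c ⁻¹' {j} = ∅ := by
        rw [← preimage_inter, singleton_inter_eq_empty.2 (by simpa using hij), preimage_empty]
      rwa [← h, inter_self] at h1
    simp [this]

theorem entPart_fibers (c : X → ι) : entPart μ f (fibers c) = entRate μ f c := by
  unfold entPart entRate
  simp only [dynRefine_fibers, partEnt_fibers]

theorem isFinPartition_fibers {c : X → ι} (hc : MeasFibers c) : IsFinPartition (fibers c) := by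
  refine ⟨?_, ?_, ?_⟩
  · intro B hB
    obtain ⟨i, -, rfl⟩ := Finset.mem_image.1 hB
    exact hc i
  · refine eq_univ_of_forall fun x => ?_
    simp only [fibers, mem_iUnion]
    exact ⟨c ⁻¹' {c x}, Finset.mem_image_of_mem _ (Finset.mem_univ _), rfl⟩
  · intro A hA B hB hAB
    obtain ⟨i, -, rfl⟩ := Finset.mem_image.1 hA
    obtain ⟨j, -, rfl⟩ := Finset.mem_image.1 hB
    refine disjoint_left.2 fun x hx hx' => hAB ?_
    simp only [id, mem_preimage, mem_singleton_iff] at hx hx'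
    rw [← hx, ← hx']

/-- The partition into fibres of `c` refines the cover `U`. -/
def Refines {X ι : Type*} (c : X → ι) (U : Finset (Set X)) : Prop := ∀ i, ∃ u ∈ U, c ⁻¹' {i} ⊆ u

theorem exists_eq_fibers {ξ : Finset (Set X)} (h : IsFinPartition (X := X) ξ) :
    ∃ c : X → ξ, (∀ B, c ⁻¹' {B} = B) ∧ fibers c = ξ := by
  have hex : ∀ x, ∃ B : ξ, x ∈ (B : Set X) := fun x => by
    have : x ∈ ⋃ B ∈ ξ, B := h.2.1 ▸ mem_univ x
    simpa only [mem_iUnion, Subtype.exists] using this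
  choose c hc using hex
  have hfib : ∀ B, c ⁻¹' {B} = B := by
    intro B
    ext x
    refine ⟨fun hx => ?_, fun hx => ?_⟩
    · rw [mem_preimage, mem_singleton_iff] at hx
      exact hx ▸ hc x
    · by_contra hne
      exact disjoint_left.1 (h.2.2 (c x).2 B.2 fun e => hne (Subtype.ext e)) (hc x) hx
  refine ⟨c, hfib, ?_⟩
  ext B
  simp only [fibers, Finset.mem_image, Finset.mem_univ, true_and, hfib]
  exact ⟨fun ⟨B', e⟩ => e ▸ B'.2, fun hB => ⟨⟨B, hB⟩, rfl⟩⟩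

theorem exists_fin_refines {U : Finset (Set X)} (hU : ∀ u ∈ U, MeasurableSet u)
    (hcover : (⋃ u ∈ U, u) = univ) :
    ∃ (k : ℕ) (c : X → Fin k), MeasFibers c ∧ Refines c U := by
  let e := U.equivFin
  have hex : ∀ x, ∃ i, x ∈ (e.symm i : Set X) ∧ ∀ j < i, x ∉ (e.symm j : Set X) := by
    intro x
    have : x ∈ ⋃ u ∈ U, u := hcover ▸ mem_univ x
    simp only [mem_iUnion] at this
    obtain ⟨u, hu, hx⟩ := this
    obtain ⟨i, hi, hmin⟩ := wellFounded_lt.has_min {i | x ∈ (e.symm i : Set X)}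
      ⟨e ⟨u, hu⟩, by simpa using hx⟩
    exact ⟨i, hi, fun j hj hxj => hmin j hxj hj⟩
  choose c hc hmin using hex
  refine ⟨_, c, fun i => ?_, fun i => ⟨e.symm i, (e.symm i).2, ?_⟩⟩
  · have : c ⁻¹' {i} = (e.symm i : Set X) ∩ ⋂ j, ⋂ _ : j < i, (e.symm j : Set X)ᶜ := by
      ext x
      simp only [mem_preimage, mem_singleton_iff, mem_inter_iff, mem_iInter, mem_compl_iff]
      refine ⟨fun h => h ▸ ⟨hc x, hmin x⟩, fun h => ?_⟩
      rcases lt_trichotomy (c x) i with hlt | heq | hgt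
      · exact absurd (hc x) (h.2 _ hlt)
      · exact heq
      · exact absurd h.1 (hmin x i hgt)
    rw [this]
    exact (hU _ (e.symm i).2).inter
      (MeasurableSet.iInter fun j => MeasurableSet.iInter fun _ => (hU _ (e.symm j).2).compl)
  · intro x hx
    rw [mem_preimage, mem_singleton_iff] at hx
    exact hx ▸ hc x

theorem entInfCover_le [IsFiniteMeasure μ] (hf : MeasurePreserving f μ μ) (hμ : μ.real univ ≤ 1)
    {U : Finset (Set X)} {c : X → ι} (hc : MeasFibers c) (hU : Refines c U) :
    entInfCover μ f U ≤ entRate μ f c := by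
  refine csInf_le ⟨0, ?_⟩ ⟨fibers c, isFinPartition_fibers hc, ?_, (entPart_fibers c).symm⟩
  · rintro _ ⟨ξ, hξ, -, rfl⟩
    obtain ⟨d, hd, hdξ⟩ := exists_eq_fibers hξ
    rw [← hdξ, entPart_fibers]
    exact entRate_nonneg hf hμ fun i => by rw [hd]; exact hξ.1 _ i.2
  · intro B hB
    obtain ⟨i, -, rfl⟩ := Finset.mem_image.1 hB
    exact hU i

theorem exists_entRate_lt {X : Type u} [MeasurableSpace X] {μ : Measure X} {f : X → X}
    {U : Finset (Set X)} (hU : ∀ u ∈ U, MeasurableSet u)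
    (hcover : (⋃ u ∈ U, u) = univ) {t : ℝ} (ht : entInfCover μ f U < t) :
    ∃ (ι : Type u) (_ : Fintype ι) (c : X → ι),
      MeasFibers c ∧ Refines c U ∧ entRate μ f c < t := by
  obtain ⟨_, ⟨ξ, hξ, hξU, rfl⟩, hlt⟩ := exists_lt_of_csInf_lt (by
    obtain ⟨k, c, hc, hcU⟩ := exists_fin_refines hU hcover
    refine ⟨_, fibers c, isFinPartition_fibers hc, ?_, rfl⟩
    intro B hB
    obtain ⟨i, -, rfl⟩ := Finset.mem_image.1 hB
    exact hcU i) ht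
  obtain ⟨c, hc, hcξ⟩ := exists_eq_fibers hξ
  refine ⟨ξ, inferInstance, c, fun i => ?_, fun i => ?_, ?_⟩
  · rw [hc]
    exact hξ.1 _ i.2
  · rw [hc]
    exact hξU _ i.2
  · rwa [← entPart_fibers, hcξ]

variable [IsFiniteMeasure μ] {ν : Measure X} [IsFiniteMeasure ν]
  {U : Finset (Set X)} (hU : ∀ u ∈ U, MeasurableSet u) (hcover : (⋃ u ∈ U, u) = univ)

include hU hcover

theorem mul_entInfCover_le (hf : MeasurePreserving f μ μ) (hμ : μ.real univ ≤ 1) (a : ℝ≥0) :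
    a * entInfCover μ f U ≤ entInfCover (a • μ) f U := by
  refine le_of_forall_gt fun t ht => ?_
  obtain ⟨ι, _, c, hc, hcU, hlt⟩ := exists_entRate_lt hU hcover ht
  rw [entRate_smul hf hμ hc] at hlt
  exact (mul_le_mul_of_nonneg_left (entInfCover_le hf hμ hc hcU) a.2).trans_lt hlt

theorem le_entInfCover_add (hfμ : MeasurePreserving f μ μ) (hfν : MeasurePreserving f ν ν)
    (hμν : (μ + ν).real univ ≤ 1) :
    entInfCover μ f U + entInfCover ν f U ≤ entInfCover (μ + ν) f U := by
  have hsum : μ.real univ + ν.real univ ≤ 1 := by rwa [← measureReal_add_apply]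
  have hμ : μ.real univ ≤ 1 := by linarith [measureReal_nonneg (μ := ν) (s := univ)]
  have hν : ν.real univ ≤ 1 := by linarith [measureReal_nonneg (μ := μ) (s := univ)]
  refine le_of_forall_gt fun t ht => ?_
  obtain ⟨ι, _, c, hc, hcU, hlt⟩ := exists_entRate_lt hU hcover ht
  rw [entRate_add hfμ hfν hμν hc] at hlt
  exact (add_le_add (entInfCover_le hfμ hμ hc hcU) (entInfCover_le hfν hν hc hcU)).trans_lt hlt

theorem entInfCover_add_le (hfμ : MeasurePreserving f μ μ) (hfν : MeasurePreserving f ν ν)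
    (hμν : (μ + ν).real univ ≤ 1) {A : Set X} (hA : MeasurableSet A) (hμA : ∀ᵐ x ∂μ, x ∈ A)
    (hνA : ∀ᵐ x ∂ν, x ∉ A) :
    entInfCover (μ + ν) f U ≤ entInfCover μ f U + entInfCover ν f U := by
  refine le_of_forall_pos_lt_add fun η hη => ?_
  obtain ⟨ι, _, c, hc, hcU, hltc⟩ := exists_entRate_lt (μ := μ) (f := f) hU hcover
    (lt_add_of_pos_right _ (half_pos hη))
  obtain ⟨κ, _, d, hd, hdU, hltd⟩ := exists_entRate_lt (μ := ν) (f := f) hU hcover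
    (lt_add_of_pos_right _ (half_pos hη))
  set g : X → ι ⊕ κ := fun x => if x ∈ A then Sum.inl (c x) else Sum.inr (d x) with hg
  have hgl : ∀ i, g ⁻¹' {Sum.inl i} = A ∩ c ⁻¹' {i} := by
    intro i
    ext x
    by_cases hx : x ∈ A <;> simp [hg, hx]
  have hgr : ∀ i, g ⁻¹' {Sum.inr i} = Aᶜ ∩ d ⁻¹' {i} := by
    intro i
    ext x
    by_cases hx : x ∈ A <;> simp [hg, hx]
  have hgm : MeasFibers g := by
    rintro (i | i)
    · rw [hgl]
      exact hA.inter (hc i)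
    · rw [hgr]
      exact hA.compl.inter (hd i)
  have hgU : Refines g U := by
    rintro (i | i)
    · obtain ⟨u, hu, h⟩ := hcU i
      exact ⟨u, hu, by rw [hgl]; exact inter_subset_right.trans h⟩
    · obtain ⟨u, hu, h⟩ := hdU i
      exact ⟨u, hu, by rw [hgr]; exact inter_subset_right.trans h⟩
  have h1 : entRate μ f g = entRate μ f c :=
    entRate_congr_of_injective Sum.inl_injective hfμ (by
      filter_upwards [hμA] with x hx
      simp [hg, hx])
  have h2 : entRate ν f g = entRate ν f d :=
    entRate_congr_of_injective Sum.inr_injective hfν (by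
      filter_upwards [hνA] with x hx
      simp [hg, hx])
  have h3 := entInfCover_le (hfμ.add_measure hfν) hμν hgm hgU
  rw [entRate_add hfμ hfν hμν hgm, h1, h2] at h3
  linarith

end CoverEntropy

section Semicontinuity

theorem abs_sub_le_card_mul {σ : Type*} [Fintype σ] {p q : σ → ℝ} (hpq : ∑ s, p s = ∑ s, q s)
    {θ : ℝ} (h : ∀ s, q s ≤ p s + θ) (s : σ) : |p s - q s| ≤ Fintype.card σ * θ := by
  have hnn : ∀ t, 0 ≤ p t - q t + θ := fun t => by linarith [h t]
  have hle : p s - q s + θ ≤ Fintype.card σ * θ := by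
    calc p s - q s + θ ≤ ∑ t, (p t - q t + θ) :=
          Finset.single_le_sum (f := fun t => p t - q t + θ) (fun t _ => hnn t) (Finset.mem_univ s)
      _ = Fintype.card σ * θ := by
          rw [Finset.sum_add_distrib, Finset.sum_sub_distrib, hpq]
          simp
  have hθ : 0 ≤ Fintype.card σ * θ := (hnn s).trans hle
  have hcard : (1 : ℝ) ≤ Fintype.card σ := by
    exact_mod_cast Fintype.card_pos_iff.2 ⟨s⟩
  have hθ' : 0 ≤ θ := nonneg_of_mul_nonneg_right hθ (by linarith)
  rw [abs_le]
  constructor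
  · nlinarith [h s]
  · linarith

variable {X : Type u} [MetricSpace X] [MeasurableSpace X] [BorelSpace X]

theorem exists_open_disjoint_enlargement {ι : Type*} [Fintype ι] {μ : Measure X} [IsFiniteMeasure μ]
    {U : Finset (Set X)} (hU : ∀ u ∈ U, IsOpen u) {c : X → ι} (hc : MeasFibers c)
    (hcU : Refines c U) {γ : ℝ≥0∞} (hγ : γ ≠ 0) :
    ∃ V : ι → Set X, (∀ i, IsOpen (V i)) ∧ Pairwise (fun i j => Disjoint (V i) (V j)) ∧
      (∀ i, ∃ u ∈ U, V i ⊆ u) ∧ ∀ i, μ (c ⁻¹' {i} \ V i) ≤ γ := by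
  choose u huU hu using hcU
  have hK : ∀ i, ∃ K ⊆ c ⁻¹' {i}, IsClosed K ∧ μ (c ⁻¹' {i} \ K) < γ := fun i =>
    (hc i).exists_isClosed_sdiff_lt (measure_ne_top _ _) hγ
  choose K hKc hKcl hKμ using hK
  refine ⟨fun i => u i ∩ ⋂ j, ⋂ _ : j ≠ i, {x | Metric.infEDist x (K i) < Metric.infEDist x (K j)},
    fun i => ?_, fun i j hij => ?_, fun i => ⟨u i, huU i, inter_subset_left⟩, fun i => ?_⟩
  · refine (hU _ (huU i)).inter (isOpen_iInter_of_finite fun j => isOpen_iInter_of_finite fun _ => ?_)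
    exact isOpen_lt Metric.continuous_infEDist Metric.continuous_infEDist
  · refine disjoint_left.2 fun x hx hx' => ?_
    have h1 : Metric.infEDist x (K i) < Metric.infEDist x (K j) := mem_iInter₂.1 hx.2 j hij.symm
    have h2 : Metric.infEDist x (K j) < Metric.infEDist x (K i) := mem_iInter₂.1 hx'.2 i hij
    exact lt_asymm h1 h2
  · refine (measure_mono (sdiff_subset_sdiff_right fun x hx => ?_)).trans (hKμ i).le
    refine ⟨hu i (hKc i hx), mem_iInter₂.2 fun j hj => ?_⟩
    change Metric.infEDist x (K i) < Metric.infEDist x (K j)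
    rw [Metric.infEDist_zero_of_mem hx, pos_iff_ne_zero]
    intro h0
    have hxj := hKc j ((Metric.mem_iff_infEDist_zero_of_closed (hKcl j)).2 h0)
    have hxi := hKc i hx
    rw [mem_preimage, mem_singleton_iff] at hxi hxj
    exact hj (hxj ▸ hxi)

theorem eventually_labelEnt_lt {ι : Type*} [Fintype ι] {f : X → X} (hf : Continuous f)
    {μ : ProbabilityMeasure X} (hμ : MeasurePreserving f (μ : Measure X) μ)
    {U : Finset (Set X)} (hU : ∀ u ∈ U, IsOpen u) {c : X → ι} (hc : MeasFibers c)
    (hcU : Refines c U) {n : ℕ} {y : ℝ} (hy : labelEnt (μ : Measure X) (itin f c n) < y) :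
    ∃ g : X → ι ⊕ ι, MeasFibers g ∧ Refines g U ∧
      ∀ᶠ ν : ProbabilityMeasure X in 𝓝 μ, labelEnt (ν : Measure X) (itin f g n) < y := by
  set q : (Fin n → ι ⊕ ι) → ℝ := fun t =>
    (μ : Measure X).real (itin f (Sum.inl ∘ c) n ⁻¹' {t}) with hq
  have hlc : MeasFibers (Sum.inl ∘ c : X → ι ⊕ ι) := by
    rintro (i | i)
    · convert hc i using 1
      ext x
      simp
    · convert MeasurableSet.empty using 1
      ext x
      simp
  have hqy : ∑ t, Real.negMulLog (q t) < y := by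
    have : labelEnt (μ : Measure X) (itin f (Sum.inl ∘ c : X → ι ⊕ ι) n) =
        labelEnt (μ : Measure X) (itin f c n) :=
      labelEnt_comp_injective (e := fun s : Fin n → ι => (Sum.inl ∘ s : Fin n → ι ⊕ ι))
        (Sum.inl_injective.comp_left) _
    rw [← this] at hy
    exact hy
  have hcont : Continuous fun p : (Fin n → ι ⊕ ι) → ℝ => ∑ t, Real.negMulLog (p t) := by fun_prop
  obtain ⟨ρ, hρ, hball⟩ := Metric.isOpen_iff.1 (isOpen_lt hcont continuous_const) q hqy
  set N : ℝ := ((Fintype.card (Fin n → ι ⊕ ι) : ℕ) : ℝ) with hN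
  have hN0 : 0 ≤ N := Nat.cast_nonneg _
  set θ : ℝ := ρ / (N + 1) with hθ
  have hθ0 : 0 < θ := by positivity
  have hNθ : N * θ < ρ := by
    rw [hθ, mul_div_assoc', div_lt_iff₀ (by positivity)]
    nlinarith
  set γ : ℝ := θ / (n + 1) with hγ
  have hγ0 : 0 < γ := by positivity
  have hnγ : n * γ < θ := by
    rw [hγ, mul_div_assoc', div_lt_iff₀ (by positivity)]
    nlinarith
  obtain ⟨V, hVo, hVd, hVU, hVμ⟩ := exists_open_disjoint_enlargement (μ := (μ : Measure X)) hU hc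
    hcU (γ := ENNReal.ofReal γ) (by simpa using hγ0)
  set g : X → ι ⊕ ι := fun x =>
    if h : ∃ i, x ∈ V i then Sum.inl h.choose else Sum.inr (c x) with hg
  have hgl : ∀ i, g ⁻¹' {Sum.inl i} = V i := by
    intro i
    ext x
    by_cases h : ∃ i, x ∈ V i
    · simp only [hg, h, mem_preimage, mem_singleton_iff, dite_true, Sum.inl.injEq]
      refine ⟨fun e => e ▸ h.choose_spec, fun hx => ?_⟩
      by_contra hne
      exact disjoint_left.1 (hVd hne) h.choose_spec hx
    · simp only [hg, h, mem_preimage, mem_singleton_iff, dite_false, reduceCtorEq, false_iff]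
      exact fun hx => h ⟨i, hx⟩
  have hgr : ∀ i, g ⁻¹' {Sum.inr i} = c ⁻¹' {i} \ ⋃ j, V j := by
    intro i
    ext x
    by_cases h : ∃ i, x ∈ V i
    · simp [hg, h]
    · simp [hg, h]
  have hgm : MeasFibers g := by
    rintro (i | i)
    · rw [hgl]
      exact (hVo i).measurableSet
    · rw [hgr]
      exact (hc i).diff (isOpen_iUnion hVo).measurableSet
  refine ⟨g, hgm, ?_, ?_⟩
  · rintro (i | i)
    · rw [hgl]
      exact hVU i
    · rw [hgr]
      obtain ⟨u, hu, h⟩ := hcU i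
      exact ⟨u, hu, sdiff_subset.trans h⟩
  have hlow : ∀ t, ∀ᶠ ν : ProbabilityMeasure X in 𝓝 μ,
      q t ≤ (ν : Measure X).real (itin f g n ⁻¹' {t}) + θ := by
    intro t
    rcases le_or_gt (q t) θ with hqt | hqt
    · exact Eventually.of_forall fun ν => by
        linarith [measureReal_nonneg (μ := (ν : Measure X)) (s := itin f g n ⁻¹' {t})]
    have hqne : q t ≠ 0 := by linarith
    have hinl : ∀ j, ∃ i, t j = Sum.inl i := by
      obtain ⟨x, hx⟩ : (itin f (Sum.inl ∘ c : X → ι ⊕ ι) n ⁻¹' {t}).Nonempty := by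
        rw [nonempty_iff_ne_empty]
        intro he
        exact hqne (by simp [hq, he])
      intro j
      refine ⟨c (f^[j] x), ?_⟩
      rw [mem_preimage, mem_singleton_iff] at hx
      rw [← hx]
      rfl
    choose s hs using hinl
    have hW : itin f g n ⁻¹' {t} = ⋂ j : Fin n, f^[j] ⁻¹' V (s j) := by
      ext x
      simp only [← hgl, mem_preimage, mem_singleton_iff, mem_iInter, funext_iff, itin, hs]
    have hWo : IsOpen (itin f g n ⁻¹' {t}) := by
      rw [hW]
      exact isOpen_iInter_of_finite fun j => (hVo _).preimage (hf.iterate j)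
    have hsub : itin f (Sum.inl ∘ c : X → ι ⊕ ι) n ⁻¹' {t} ⊆
        (itin f g n ⁻¹' {t}) ∪ ⋃ j : Fin n, f^[j] ⁻¹' (c ⁻¹' {s j} \ V (s j)) := by
      intro x hx
      have hx' : ∀ j : Fin n, c (f^[j] x) = s j := by
        simpa only [mem_preimage, mem_singleton_iff, funext_iff, itin, Function.comp_apply, hs,
          Sum.inl.injEq] using hx
      by_cases h : ∀ j : Fin n, f^[j] x ∈ V (s j)
      · exact Or.inl (hW ▸ mem_iInter.2 h)
      · obtain ⟨j, hj⟩ := not_forall.1 h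
        exact Or.inr (mem_iUnion.2 ⟨j, hx' j, hj⟩)
    have hreal : q t ≤ (μ : Measure X).real (itin f g n ⁻¹' {t}) + n * γ := by
      refine (measureReal_mono hsub).trans ((measureReal_union_le _ _).trans ?_)
      gcongr
      refine (measureReal_iUnion_fintype_le _).trans ?_
      have : ∀ j : Fin n, (μ : Measure X).real (f^[j] ⁻¹' (c ⁻¹' {s j} \ V (s j))) ≤ γ := by
        intro j
        rw [measureReal_def, (hμ.iterate j).measure_preimage
          ((hc _).diff (hVo _).measurableSet).nullMeasurableSet]
        exact ENNReal.toReal_le_of_le_ofReal hγ0.le (hVμ _)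
      exact (Finset.sum_le_sum fun j _ => this j).trans (by simp)
    have hlt : ENNReal.ofReal (q t - θ) < (μ : Measure X) (itin f g n ⁻¹' {t}) := by
      rw [ENNReal.ofReal_lt_iff_lt_toReal (by linarith) (measure_ne_top _ _)]
      change _ < (μ : Measure X).real _
      linarith
    have hev := eventually_lt_of_lt_liminf (hlt.trans_le
      (ProbabilityMeasure.le_liminf_measure_open_of_tendsto (L := 𝓝 μ) (μs := id) tendsto_id hWo))
    filter_upwards [hev] with ν hν
    rw [ENNReal.ofReal_lt_iff_lt_toReal (by linarith) (measure_ne_top _ _)] at hν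
    change _ < (ν : Measure X).real _ at hν
    linarith
  filter_upwards [eventually_all.2 hlow] with ν hν
  have hsum : ∑ t, (ν : Measure X).real (itin f g n ⁻¹' {t}) = ∑ t, q t := by
    rw [sum_measureReal_fiber (hgm.itin hf.measurable n),
      sum_measureReal_fiber (hlc.itin hf.measurable n)]
    simp
  refine hball (Metric.mem_ball.2 ((dist_pi_lt_iff hρ).2 fun t => ?_) :
    (fun t => (ν : Measure X).real (itin f g n ⁻¹' {t})) ∈ _)
  rw [Real.dist_eq]
  exact (abs_sub_le_card_mul hsum hν t).trans_lt hNθ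

theorem eventually_entInfCover_lt {f : X → X} (hf : Continuous f)
    {μ : ProbabilityMeasure X} (hμ : MeasurePreserving f (μ : Measure X) μ)
    {U : Finset (Set X)} (hU : ∀ u ∈ U, IsOpen u) (hcover : (⋃ u ∈ U, u) = univ)
    {y : ℝ} (hy : entInfCover (μ : Measure X) f U < y) :
    ∀ᶠ ν : ProbabilityMeasure X in 𝓝 μ, MeasurePreserving f (ν : Measure X) ν →
      entInfCover (ν : Measure X) f U < y := by
  obtain ⟨ι, _, c, hc, hcU, hlt⟩ :=
    exists_entRate_lt (fun u hu => (hU u hu).measurableSet) hcover hy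
  obtain ⟨n, hn, hn0⟩ := (((tendsto_entRate hμ (by simp) hc).eventually_lt_const hlt).and
    (eventually_ne_atTop 0)).exists
  have hnpos : (0 : ℝ) < n := by positivity
  rw [div_lt_iff₀ hnpos] at hn
  obtain ⟨g, hg, hgU, hev⟩ := eventually_labelEnt_lt hf hμ hU hc hcU hn
  filter_upwards [hev] with ν hν hfν
  refine (entInfCover_le hfν (by simp) hg hgU).trans_lt
    ((entRate_le_div hfν (by simp) hg hn0).trans_lt ?_)
  rwa [div_lt_iff₀ hnpos]

end Semicontinuity

section Splitting

theorem exists_complementary_weights (p q : Fin 3 → ℝ) :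
    ∃ a b : Fin 3 → ℝ≥0, (∀ i, a i + b i = 2) ∧ a ≠ b ∧
      ∑ i, (a i : ℝ) * p i = ∑ i, p i ∧ ∑ i, (a i : ℝ) * q i = ∑ i, q i := by
  let T : (Fin 3 → ℝ) →ₗ[ℝ] (Fin 2 → ℝ) := Matrix.toLin' !![p 0, p 1, p 2; q 0, q 1, q 2]
  obtain ⟨s, hs, hs0⟩ := (Submodule.ne_bot_iff _).1
    (LinearMap.ker_ne_bot_of_finrank_lt (f := T) (by simp))
  have hTs : T s = 0 := hs
  have hp : s 0 * p 0 + s 1 * p 1 + s 2 * p 2 = 0 := by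
    have := congrFun hTs 0
    simp [T, Matrix.mulVec, dotProduct, Fin.sum_univ_three] at this
    linarith
  have hq : s 0 * q 0 + s 1 * q 1 + s 2 * q 2 = 0 := by
    have := congrFun hTs 1
    simp [T, Matrix.mulVec, dotProduct, Fin.sum_univ_three] at this
    linarith
  have hn : 0 < ‖s‖ := norm_pos_iff.2 hs0
  have hle : ∀ i, |s i / ‖s‖| ≤ 1 := fun i => by
    rw [abs_div, abs_norm, div_le_one hn]
    exact norm_le_pi_norm s i
  have hp' : s 0 / ‖s‖ * p 0 + s 1 / ‖s‖ * p 1 + s 2 / ‖s‖ * p 2 = 0 := by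
    field_simp
    linarith
  have hq' : s 0 / ‖s‖ * q 0 + s 1 / ‖s‖ * q 1 + s 2 / ‖s‖ * q 2 = 0 := by
    field_simp
    linarith
  have hw : ∀ i, 0 ≤ 1 + s i / ‖s‖ ∧ 0 ≤ 1 - s i / ‖s‖ := fun i => by
    constructor <;> linarith [abs_le.1 (hle i)]
  have ha : ∀ i, ((1 + s i / ‖s‖).toNNReal : ℝ) = 1 + s i / ‖s‖ := fun i =>
    Real.coe_toNNReal _ (hw i).1
  have hb : ∀ i, ((1 - s i / ‖s‖).toNNReal : ℝ) = 1 - s i / ‖s‖ := fun i =>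
    Real.coe_toNNReal _ (hw i).2
  refine ⟨fun i => (1 + s i / ‖s‖).toNNReal, fun i => (1 - s i / ‖s‖).toNNReal, fun i => ?_,
    fun h => hs0 ?_, ?_, ?_⟩
  · ext
    rw [NNReal.coe_add, ha, hb]
    push_cast
    ring
  · ext i
    have h2 := congrArg NNReal.toReal (congrFun h i)
    rw [ha, hb] at h2
    have h3 : s i / ‖s‖ = 0 := by linarith
    simpa [hn.ne'] using h3
  · simp only [Fin.sum_univ_three, ha]
    linarith
  · simp only [Fin.sum_univ_three, ha]
    linarith

variable {X : Type u} [MeasurableSpace X]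

theorem le_entInfCover_weighted_add {f : X → X} {U : Finset (Set X)}
    (hU : ∀ u ∈ U, MeasurableSet u) (hcover : (⋃ u ∈ U, u) = univ) {m : Fin 3 → Measure X}
    [∀ i, IsFiniteMeasure (m i)] (hm : ∀ i, MeasurePreserving f (m i) (m i))
    (hm1 : ∀ i, (m i).real univ ≤ 1) (a : Fin 3 → ℝ≥0)
    (ha : (∑ i, a i • m i).real univ ≤ 1) :
    ∑ i, a i * entInfCover (m i) f U ≤ entInfCover (∑ i, a i • m i) f U := by
  rw [Fin.sum_univ_three] at ha
  rw [Fin.sum_univ_three, Fin.sum_univ_three]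
  have hs := fun i => (hm i).smul_measure (a i)
  have h01 : (a 0 • m 0 + a 1 • m 1).real univ ≤ 1 := by
    rw [measureReal_add_apply] at ha
    linarith [measureReal_nonneg (μ := a 2 • m 2) (s := univ)]
  have h1 := le_entInfCover_add hU hcover (hs 0) (hs 1) h01
  have h2 := le_entInfCover_add hU hcover ((hs 0).add_measure (hs 1)) (hs 2) ha
  have h := fun i => mul_entInfCover_le hU hcover (hm i) (hm1 i) (a i)
  linarith [h 0, h 1, h 2]

theorem exists_invariant_decomposition {f : X → X} {ν : Measure X} [IsProbabilityMeasure ν]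
    (hf : MeasurePreserving f ν ν) {U : Finset (Set X)}
    (hU : ∀ u ∈ U, MeasurableSet u) (hcover : (⋃ u ∈ U, u) = univ) {φ : X → ℝ}
    (hφ : Integrable φ ν) {A B : Set X} (hA : MeasurableSet A) (hB : MeasurableSet B)
    (hfA : f ⁻¹' A = A) (hfB : f ⁻¹' B = B) (hAB : A ⊆ B) (hA0 : ν A ≠ 0)
    (hBA0 : ν (B \ A) ≠ 0) (hB0 : ν Bᶜ ≠ 0) :
    ∃ ν₁ ν₂ : Measure X, IsProbabilityMeasure ν₁ ∧ IsProbabilityMeasure ν₂ ∧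
      MeasurePreserving f ν₁ ν₁ ∧ MeasurePreserving f ν₂ ν₂ ∧ ν₁ + ν₂ = (2 : ℝ≥0) • ν ∧
      ν₁ ≠ ν₂ ∧ ∫ x, φ x ∂ν₁ = ∫ x, φ x ∂ν ∧
      2 * entInfCover ν f U ≤ entInfCover ν₁ f U + entInfCover ν₂ f U := by
  let S : Fin 3 → Set X := ![A, B \ A, Bᶜ]
  have hS : ∀ i, MeasurableSet (S i) := by
    intro i
    fin_cases i
    exacts [hA, hB.diff hA, hB.compl]
  have hfS : ∀ i, f ⁻¹' S i = S i := by
    intro i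
    fin_cases i <;> simp [S, preimage_sdiff, preimage_compl, hfA, hfB]
  have hS0 : ∀ i, ν (S i) ≠ 0 := by
    intro i
    fin_cases i
    exacts [hA0, hBA0, hB0]
  have hSd : ∀ i j, i ≠ j → Disjoint (S i) (S j) := by
    have h1 : Disjoint A (B \ A) := disjoint_sdiff_right
    have h2 : Disjoint A Bᶜ := disjoint_compl_right_iff_subset.2 hAB
    have h3 : Disjoint (B \ A) Bᶜ := disjoint_compl_right_iff_subset.2 sdiff_subset
    intro i j hij
    fin_cases i <;> fin_cases j <;> first | exact absurd rfl hij | skip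
    exacts [h1, h2, h1.symm, h3, h2.symm, h3.symm]
  let m : Fin 3 → Measure X := fun i => ν.restrict (S i)
  have hm : ∀ i, MeasurePreserving f (m i) (m i) := fun i => by
    have := hf.restrict_preimage (hS i)
    rwa [hfS] at this
  have hm1 : ∀ i, (m i).real univ ≤ 1 := fun i => by
    simp only [m, measureReal_restrict_apply_univ]
    exact measureReal_le_one
  have h01 : m 0 + m 1 = ν.restrict B := by
    change ν.restrict A + ν.restrict (B \ A) = _
    rw [← Measure.restrict_union disjoint_sdiff_right (hB.diff hA), union_sdiff_cancel hAB]
  have hsum : m 0 + m 1 + m 2 = ν := by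
    rw [h01]
    exact Measure.restrict_add_restrict_compl hB
  have hint : ∀ i, Integrable φ (m i) := fun i => hφ.restrict
  have hintw : ∀ (w : Fin 3 → ℝ≥0) (g : X → ℝ), (∀ i, Integrable g (m i)) →
      ∫ x, g x ∂(∑ i, w i • m i) = ∑ i, (w i : ℝ) * ∫ x, g x ∂(m i) := fun w g hg => by
    rw [integral_finsetSum_measure fun i _ => (hg i).smul_measure_nnreal]
    exact Finset.sum_congr rfl fun i _ => integral_smul_nnreal_measure _ _
  have hmass : ∀ w : Fin 3 → ℝ≥0,
      (∑ i, w i • m i).real univ = ∑ i, (w i : ℝ) * (m i).real univ := fun w => by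
    simpa using hintw w (fun _ => 1) fun i => integrable_const _
  have hsum' : ∑ i, (1 : ℝ≥0) • m i = ν := by simpa [Fin.sum_univ_three] using hsum
  have hφsum : ∑ i, ∫ x, φ x ∂(m i) = ∫ x, φ x ∂ν := by
    have := hintw (fun _ => 1) φ hint
    rw [hsum'] at this
    simpa using this.symm
  have hmsum : ∑ i, (m i).real univ = 1 := by
    have := hmass (fun _ => 1)
    rw [hsum'] at this
    simpa using this.symm
  obtain ⟨a, b, hab, hne, hap, haq⟩ :=
    exists_complementary_weights (fun i => (m i).real univ) (fun i => ∫ x, φ x ∂(m i))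
  have habR : ∀ i, (b i : ℝ) = 2 - a i := fun i => by
    have := congrArg NNReal.toReal (hab i)
    push_cast at this
    linarith
  have hma : (∑ i, a i • m i).real univ = 1 := by rw [hmass, hap, hmsum]
  have hmb : (∑ i, b i • m i).real univ = 1 := by
    rw [hmass]
    simp only [habR, sub_mul, Finset.sum_sub_distrib, hap, ← Finset.mul_sum, hmsum]
    norm_num
  have hpres : ∀ w : Fin 3 → ℝ≥0,
      MeasurePreserving f (∑ i, w i • m i) (∑ i, w i • m i) := fun w => by
    rw [Fin.sum_univ_three]
    have hs := fun i => (hm i).smul_measure (w i)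
    exact ((hs 0).add_measure (hs 1)).add_measure (hs 2)
  have hadd : ∑ i, a i • m i + ∑ i, b i • m i = (2 : ℝ≥0) • ν := by
    rw [← Finset.sum_add_distrib, ← hsum, ← Fin.sum_univ_three, Finset.smul_sum]
    exact Finset.sum_congr rfl fun i _ => by rw [← add_smul, hab]
  refine ⟨∑ i, a i • m i, ∑ i, b i • m i,
    ⟨by simpa [measureReal_def, ENNReal.toReal_eq_one_iff] using hma⟩,
    ⟨by simpa [measureReal_def, ENNReal.toReal_eq_one_iff] using hmb⟩,
    hpres a, hpres b, hadd, fun h => hne ?_, by rw [hintw a φ hint, haq, hφsum], ?_⟩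
  · have key : ∀ (w : Fin 3 → ℝ≥0) i, (∑ j, w j • m j) (S i) = w i * ν (S i) := fun w i => by
      rw [Measure.finsetSum_apply, Finset.sum_eq_single i]
      · rw [Measure.smul_apply, Measure.restrict_apply_self]
        rfl
      · intro j _ hji
        simp [m, Measure.restrict_apply (hS i), (hSd i j hji.symm).inter_eq]
      · simp
    ext i
    have h2 := key a i
    rw [h, key b i, ENNReal.mul_left_inj (hS0 i) (measure_ne_top _ _)] at h2
    exact_mod_cast h2.symm
  · have h1 := le_entInfCover_weighted_add hU hcover hm hm1 a hma.le
    have h2 := le_entInfCover_weighted_add hU hcover hm hm1 b hmb.le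
    simp only [habR, sub_mul, Finset.sum_sub_distrib, ← Finset.mul_sum] at h2
    have hν1 : (m 0 + m 1 + m 2).real univ ≤ 1 := by rw [hsum]; exact measureReal_le_one
    have hB1 : (m 0 + m 1).real univ ≤ 1 := by
      rw [measureReal_add_apply] at hν1
      linarith [measureReal_nonneg (μ := m 2) (s := univ)]
    have h3 := entInfCover_add_le hU hcover ((hm 0).add_measure (hm 1)) (hm 2) hν1 hB
      (by rw [h01]; exact ae_restrict_mem hB) (ae_restrict_mem hB.compl)
    have h4 := entInfCover_add_le hU hcover (hm 0) (hm 1) hB1 hA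
      (ae_restrict_mem hA) ((ae_restrict_mem (hB.diff hA)).mono fun x hx => hx.2)
    rw [hsum] at h3
    rw [Fin.sum_univ_three (fun i => entInfCover (m i) f U)] at h2
    linarith

theorem ergodic_cond {f : X → X} {ν : Measure X} [IsFiniteMeasure ν]
    (hf : MeasurePreserving f ν ν) {A : Set X} (hA : MeasurableSet A) (hfA : f ⁻¹' A = A)
    (H : ∀ B ⊆ A, MeasurableSet B → f ⁻¹' B = B → ν B = 0 ∨ ν (A \ B) = 0) :
    Ergodic f (ProbabilityTheory.cond ν A) := by
  have hr := hf.restrict_preimage hA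
  rw [hfA] at hr
  refine { toMeasurePreserving := hr.smul_measure (ν A)⁻¹, toPreErgodic := ⟨fun s hs hfs => ?_⟩ }
  rw [eventuallyConst_set']
  rcases H (A ∩ s) inter_subset_left (hA.inter hs) (by rw [preimage_inter, hfA, hfs]) with h | h
  · left
    rw [ae_eq_empty, ProbabilityTheory.cond_apply hA, h, mul_zero]
  · right
    rw [ae_eq_univ, ProbabilityTheory.cond_apply hA, ← sdiff_eq, ← sdiff_self_inter, h,
      mul_zero]

theorem exists_ergodic_combination_eq {f : X → X} {ν : Measure X} [IsProbabilityMeasure ν]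
    (hf : MeasurePreserving f ν ν)
    (H : ∀ A B, MeasurableSet A → MeasurableSet B → f ⁻¹' A = A → f ⁻¹' B = B → A ⊆ B →
      ν A = 0 ∨ ν (B \ A) = 0 ∨ ν Bᶜ = 0) :
    ∃ (j : ℕ) (l : Fin j → ℝ) (τ : Fin j → Measure X), (∀ i, 0 < l i) ∧ ∑ i, l i = 1 ∧
      (∀ i, IsProbabilityMeasure (τ i)) ∧ (∀ i, Ergodic f (τ i)) ∧
      ∑ i, ENNReal.ofReal (l i) • τ i = ν := by
  by_cases he : Ergodic f ν
  · exact ⟨1, fun _ => 1, fun _ => ν, by simp, by simp, fun _ => inferInstance, fun _ => he,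
      by simp⟩
  obtain ⟨A, hA, hfA, hA0, hA1⟩ :
      ∃ A, MeasurableSet A ∧ f ⁻¹' A = A ∧ ν A ≠ 0 ∧ ν Aᶜ ≠ 0 := by
    by_contra! hcon
    refine he { toMeasurePreserving := hf, toPreErgodic := ⟨fun s hs hfs => ?_⟩ }
    rw [eventuallyConst_set', ae_eq_empty, ae_eq_univ]
    exact or_iff_not_imp_left.2 (hcon s hs hfs)
  have hfA' : f ⁻¹' Aᶜ = Aᶜ := by rw [preimage_compl, hfA]
  have h1 : Ergodic f (ProbabilityTheory.cond ν A) := ergodic_cond hf hA hfA fun B hBA hB hfB =>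
    (H B A hB hA hfB hfA hBA).imp_right fun h => h.resolve_right hA1
  have h2 : Ergodic f (ProbabilityTheory.cond ν Aᶜ) :=
    ergodic_cond hf hA.compl hfA' fun B hBA hB hfB => by
      have := (H A (A ∪ B) hA (hA.union hB) hfA (by rw [preimage_union, hfA, hfB])
        subset_union_left).resolve_left hA0
      rwa [union_sdiff_left, (disjoint_left.2 hBA : Disjoint B A).sdiff_eq_left, compl_union,
        ← sdiff_eq] at this
  have hcond : ∀ s, ν s ≠ 0 → ENNReal.ofReal (ν.real s) • ProbabilityTheory.cond ν s =
      ν.restrict s := fun s hs => by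
    rw [ofReal_measureReal, ProbabilityTheory.cond, smul_smul,
      ENNReal.mul_inv_cancel hs (measure_ne_top _ _), one_smul]
  refine ⟨2, ![ν.real A, ν.real Aᶜ], ![ProbabilityTheory.cond ν A, ProbabilityTheory.cond ν Aᶜ],
    ?_, ?_, ?_, ?_, ?_⟩
  · simp only [Fin.forall_fin_two]
    exact ⟨ENNReal.toReal_pos hA0 (measure_ne_top _ _), ENNReal.toReal_pos hA1 (measure_ne_top _ _)⟩
  · simp [Fin.sum_univ_two, measureReal_add_measureReal_compl hA]
  · simp only [Fin.forall_fin_two]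
    exact ⟨ProbabilityTheory.cond_isProbabilityMeasure hA0,
      ProbabilityTheory.cond_isProbabilityMeasure hA1⟩
  · simp only [Fin.forall_fin_two]
    exact ⟨h1, h2⟩
  · rw [Fin.sum_univ_two]
    exact (congrArg₂ _ (hcond A hA0) (hcond Aᶜ hA1)).trans (Measure.restrict_add_restrict_compl hA)

end Splitting

section Maximizer

variable {X : Type u} [MetricSpace X] [MeasurableSpace X] [BorelSpace X]

theorem isClosed_setOf_measurePreserving {f : X → X} (hf : Continuous f) :
    IsClosed {ν : ProbabilityMeasure X | MeasurePreserving f (ν : Measure X) ν} := by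
  have : {ν : ProbabilityMeasure X | MeasurePreserving f (ν : Measure X) ν} =
      {ν | ν.map hf.aemeasurable = ν} := by
    ext ν
    refine ⟨fun h => Subtype.ext h.map_eq, fun h => ⟨hf.measurable, congrArg Subtype.val h⟩⟩
  rw [this]
  exact isClosed_eq (ProbabilityMeasure.continuous_map hf) continuous_id

variable [CompactSpace X]

/-- Any nonempty compact set of probability measures has an element that is not the midpoint of
two distinct elements of the set. -/
theorem exists_not_midpoint {M : Set (ProbabilityMeasure X)} (hM : IsCompact M)
    (hne : M.Nonempty) :
    ∃ ν ∈ M, ∀ ν₁ ∈ M, ∀ ν₂ ∈ M,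
      (ν₁ : Measure X) + (ν₂ : Measure X) = (2 : ℝ≥0) • (ν : Measure X) → ν₁ = ν₂ := by
  let G : ProbabilityMeasure X → C(X, ℝ) → ℝ := fun ν g => ∫ x, g x ∂(ν : Measure X)
  have hG : Continuous G :=
    continuous_pi fun g => ProbabilityMeasure.continuous_integral_continuousMap g
  have hGinj : Function.Injective G := fun ν₁ ν₂ h => ProbabilityMeasure.toMeasure_injective <|
    ext_of_forall_integral_eq_of_IsFiniteMeasure fun g => congrFun h g.toContinuousMap
  obtain ⟨_, hν⟩ := (hM.image hG).extremePoints_nonempty (hne.image G)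
  obtain ⟨⟨ν, hνM, rfl⟩, hext⟩ := mem_extremePoints.1 hν
  refine ⟨ν, hνM, fun ν₁ h₁ ν₂ h₂ h => hGinj ?_⟩
  have hmid : G ν ∈ openSegment ℝ (G ν₁) (G ν₂) := by
    refine ⟨1 / 2, 1 / 2, by norm_num, by norm_num, by norm_num, funext fun g => ?_⟩
    have hint : ∀ τ : ProbabilityMeasure X, Integrable g (τ : Measure X) := fun τ =>
      g.continuous.integrable_of_hasCompactSupport (HasCompactSupport.of_compactSpace g)
    have hg : ∫ x, g x ∂((ν₁ : Measure X) + (ν₂ : Measure X)) =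
        ∫ x, g x ∂((2 : ℝ≥0) • (ν : Measure X)) := by
      rw [h]
    rw [integral_add_measure (hint _) (hint _), integral_smul_nnreal_measure, NNReal.smul_def] at hg
    simp only [G, Pi.add_apply, Pi.smul_apply, smul_eq_mul, NNReal.coe_ofNat] at hg ⊢
    linarith
  obtain ⟨e₁, e₂⟩ := hext _ (mem_image_of_mem G h₁) _ (mem_image_of_mem G h₂) hmid
  exact e₁.trans e₂.symm

theorem exists_maximizer {f : X → X} (hf : Continuous f) {φ ψ : X → ℝ} (hφ : Continuous φ)
    (hψ : Continuous ψ) {μ : ProbabilityMeasure X} (hμ : MeasurePreserving f (μ : Measure X) μ)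
    {U : Finset (Set X)} (hU : ∀ u ∈ U, IsOpen u) (hcover : (⋃ u ∈ U, u) = univ) (t : ℝ) :
    ∃ ν : ProbabilityMeasure X, MeasurePreserving f (ν : Measure X) ν ∧
      ∫ x, φ x ∂(ν : Measure X) = ∫ x, φ x ∂(μ : Measure X) ∧
      entInfCover (μ : Measure X) f U + t * ∫ x, ψ x ∂(μ : Measure X) ≤
        entInfCover (ν : Measure X) f U + t * ∫ x, ψ x ∂(ν : Measure X) ∧
      ∀ A B, MeasurableSet A → MeasurableSet B → f ⁻¹' A = A → f ⁻¹' B = B → A ⊆ B →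
        (ν : Measure X) A = 0 ∨ (ν : Measure X) (B \ A) = 0 ∨ (ν : Measure X) Bᶜ = 0 := by
  have hcont : ∀ {g : X → ℝ}, Continuous g →
      Continuous fun ν : ProbabilityMeasure X => ∫ x, g x ∂(ν : Measure X) := fun {g} hg =>
    ProbabilityMeasure.continuous_integral_continuousMap (⟨g, hg⟩ : C(X, ℝ))
  have hint : ∀ {g : X → ℝ}, Continuous g → ∀ τ : Measure X, [IsFiniteMeasure τ] →
      Integrable g τ := fun {g} hg τ _ =>
    hg.integrable_of_hasCompactSupport (HasCompactSupport.of_compactSpace g)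
  let F : ProbabilityMeasure X → ℝ := fun ν =>
    entInfCover (ν : Measure X) f U + t * ∫ x, ψ x ∂(ν : Measure X)
  let K : Set (ProbabilityMeasure X) := {ν | MeasurePreserving f (ν : Measure X) ν} ∩
    {ν | ∫ x, φ x ∂(ν : Measure X) = ∫ x, φ x ∂(μ : Measure X)}
  have hK : IsCompact K :=
    ((isClosed_setOf_measurePreserving hf).inter (isClosed_eq (hcont hφ) continuous_const)).isCompact
  have hF : UpperSemicontinuousOn F K := by
    refine UpperSemicontinuousOn.add (fun ν hν y hy => ?_)
      ((continuous_const.mul (hcont hψ)).upperSemicontinuous.upperSemicontinuousOn K)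
    rw [eventually_nhdsWithin_iff]
    exact (eventually_entInfCover_lt hf hν.1 hU hcover hy).mono fun τ h hτ => h hτ.1
  have hμK : μ ∈ K := ⟨hμ, rfl⟩
  obtain ⟨ν₀, hν₀, hmax⟩ := hF.exists_isMaxOn ⟨μ, hμK⟩ hK
  have hM : IsCompact (K ∩ {ν | F ν₀ ≤ F ν}) := hF.isCompact_inter_preimage_Ici hK (F ν₀)
  obtain ⟨ν, ⟨hνK, hν⟩, hmid⟩ := exists_not_midpoint hM ⟨ν₀, hν₀, le_refl (F ν₀)⟩
  refine ⟨ν, hνK.1, hνK.2, (hmax hμK).trans hν, fun A B hA hB hfA hfB hAB => ?_⟩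
  by_contra! hcon
  obtain ⟨ν₁, ν₂, hp₁, hp₂, hf₁, hf₂, hadd, hne, hφ₁, hent⟩ :=
    exists_invariant_decomposition hνK.1 (fun u hu => (hU u hu).measurableSet) hcover
      (hint hφ _) hA hB hfA hfB hAB hcon.1 hcon.2.1 hcon.2.2
  have hsum : ∀ {g : X → ℝ}, Continuous g →
      ∫ x, g x ∂ν₁ + ∫ x, g x ∂ν₂ = 2 * ∫ x, g x ∂(ν : Measure X) := fun {g} hg => by
    rw [← integral_add_measure (hint hg _) (hint hg _), hadd, integral_smul_nnreal_measure,
      NNReal.smul_def]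
    simp
  have hφ₂ : ∫ x, φ x ∂ν₂ = ∫ x, φ x ∂(ν : Measure X) := by linarith [hsum hφ]
  have hK₁ : (⟨ν₁, hp₁⟩ : ProbabilityMeasure X) ∈ K := ⟨hf₁, hφ₁.trans hνK.2⟩
  have hK₂ : (⟨ν₂, hp₂⟩ : ProbabilityMeasure X) ∈ K := ⟨hf₂, hφ₂.trans hνK.2⟩
  have hm₁ : F ⟨ν₁, hp₁⟩ ≤ F ν₀ := hmax hK₁
  have hm₂ : F ⟨ν₂, hp₂⟩ ≤ F ν₀ := hmax hK₂
  have hν' : F ν₀ ≤ F ν := hν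
  have hFF : 2 * F ν ≤ F ⟨ν₁, hp₁⟩ + F ⟨ν₂, hp₂⟩ := by
    have h := congrArg (t * ·) (hsum hψ)
    simp only [F, ProbabilityMeasure.coe_mk] at h ⊢
    linarith
  exact hne (congrArg Subtype.val (hmid ⟨ν₁, hp₁⟩ ⟨hK₁, show F ν₀ ≤ _ by linarith⟩ ⟨ν₂, hp₂⟩
    ⟨hK₂, show F ν₀ ≤ _ by linarith⟩ hadd))

end Maximizer

end PaperMMD

/-- **Lemma 3.6.** An invariant measure can be approximated, for the purposes of the
quantity `inf_{ξ≻U} h_·(f,ξ) + log(1/ε)∫ψ d·` and of `∫φ d·`, by a finite convex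
combination of ergodic measures. -/
theorem PaperMMD.ergodic_combination_approx
    {X : Type*} [MetricSpace X] [CompactSpace X] [MeasurableSpace X] [BorelSpace X]
    (f : X → X) (hf : Continuous f) (φ ψ : X → ℝ) (hφ : Continuous φ) (hψ : Continuous ψ)
    (μ : MeasureTheory.Measure X) (hμp : MeasureTheory.IsProbabilityMeasure μ)
    (hμinv : μ.map f = μ)
    (U : Finset (Set X)) (hUopen : ∀ u ∈ U, IsOpen u) (hUcover : (⋃ u ∈ U, u) = Set.univ)
    (ε δ : ℝ) (hε : 0 < ε) (hδ : 0 < δ)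
    (hbdd : BddAbove {r : ℝ | ∃ τ : MeasureTheory.Measure X,
      MeasureTheory.IsProbabilityMeasure τ ∧ Ergodic f τ ∧
      r = PaperMMD.entInfCover τ f U + Real.log (1 / ε) * ∫ x, ψ x ∂τ}) :
    ∃ (j : ℕ) (l : Fin j → ℝ) (ν : Fin j → MeasureTheory.Measure X),
      (∀ i, 0 < l i) ∧ (∑ i, l i = 1) ∧
      (∀ i, MeasureTheory.IsProbabilityMeasure (ν i)) ∧ (∀ i, Ergodic f (ν i)) ∧
      (PaperMMD.entInfCover μ f U + Real.log (1 / ε) * ∫ x, ψ x ∂μ ≤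
        PaperMMD.entInfCover (∑ i, ENNReal.ofReal (l i) • ν i) f U
          + Real.log (1 / ε) * (∫ x, ψ x ∂(∑ i, ENNReal.ofReal (l i) • ν i)) + δ) ∧
      |(∫ x, φ x ∂(∑ i, ENNReal.ofReal (l i) • ν i)) - ∫ x, φ x ∂μ| < δ := by
  have hinv : MeasureTheory.MeasurePreserving f μ μ := ⟨hf.measurable, hμinv⟩
  obtain ⟨ν, hfν, hφν, hle, H⟩ := PaperMMD.exists_maximizer hf hφ hψ
    (μ := (⟨μ, hμp⟩ : MeasureTheory.ProbabilityMeasure X)) hinv hUopen hUcover (Real.log (1 / ε))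
  obtain ⟨j, l, τ, hl, hl1, hp, he, hsum⟩ := PaperMMD.exists_ergodic_combination_eq hfν H
  refine ⟨j, l, τ, hl, hl1, hp, he, ?_, ?_⟩
  · rw [hsum]
    exact hle.trans (le_add_of_nonneg_right hδ.le)
  · rw [hsum, hφν, MeasureTheory.ProbabilityMeasure.coe_mk, sub_self, abs_zero]
    exact hδ
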